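/- Let v̲ ≤ v̄ be reals and let π, p : [v̲, v̄] → ℝ with π integrable on [v̲, v̄]. Say (π, p) is truthful if for all v, v' ∈ [v̲, v̄]: v·π(v) − p(v) ≥ v·π(v') − p(v'). Then (π, p) is truthful if and only if (i) π is non-decreasing on [v̲, v̄], and (ii) for all v ∈ [v̲, v̄], p(v) = v·π(v) − v̲·π(v̲) + p(v̲) − ∫_{v̲}^{v} π(s) ds. -/

import Mathlib

open MeasureTheory Set

/-- A function on an interval whose increments over `[x, y]` are bounded by
`(y - x) * (g y - g x)` is constant. -/
theorem eq_of_abs_sub_le_mul_sub {s : Set ℝ} (hs : s.OrdConnected) {D g : ℝ → ℝ}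
    (h : ∀ x ∈ s, ∀ y ∈ s, x ≤ y → |D y - D x| ≤ (y - x) * (g y - g x))
    {a b : ℝ} (ha : a ∈ s) (hb : b ∈ s) (hab : a ≤ b) : D a = D b := by
  have bisect : ∀ n : ℕ, ∀ x ∈ s, ∀ y ∈ s, x ≤ y →
      |D y - D x| ≤ (y - x) * (g y - g x) * (1 / 2) ^ n := by
    intro n
    induction n with
    | zero => simpa using h
    | succ n ih =>
      intro x hx y hy hxy
      have hxm : x ≤ (x + y) / 2 := by linarith
      have hmy : (x + y) / 2 ≤ y := by linarith
      have hm : (x + y) / 2 ∈ s := hs.out hx hy ⟨hxm, hmy⟩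
      calc |D y - D x| ≤ |D y - D ((x + y) / 2)| + |D ((x + y) / 2) - D x| :=
            abs_sub_le _ _ _
        _ ≤ _ := add_le_add (ih _ hm _ hy hmy) (ih _ hx _ hm hxm)
        _ = _ := by ring
  have lim : Filter.Tendsto (fun n : ℕ => (b - a) * (g b - g a) * (1 / 2 : ℝ) ^ n)
      Filter.atTop (nhds 0) := by
    simpa using (tendsto_pow_atTop_nhds_zero_of_lt_one (r := (1 / 2 : ℝ))
      (by norm_num) (by norm_num)).const_mul ((b - a) * (g b - g a))
  have h0 : |D b - D a| ≤ 0 := ge_of_tendsto' lim fun n => bisect n a ha b hb hab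
  linarith [abs_nonpos_iff.mp h0]

theorem MonotoneOn.intervalIntegral_mem_Icc {f : ℝ → ℝ} {a b : ℝ} (hab : a ≤ b)
    (hf : MonotoneOn f (Icc a b)) :
    ∫ s in a..b, f s ∈ Icc ((b - a) * f a) ((b - a) * f b) := by
  have hint : IntervalIntegrable f volume a b :=
    MonotoneOn.intervalIntegrable (by rwa [uIcc_of_le hab])
  constructor
  · simpa using intervalIntegral.integral_mono_on hab
      (intervalIntegrable_const (c := f a)) hint
      fun x hx => hf (left_mem_Icc.2 hab) hx hx.1
  · simpa using intervalIntegral.integral_mono_on hab hint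
      (intervalIntegrable_const (c := f b))
      fun x hx => hf hx (right_mem_Icc.2 hab) hx.2

/-- Myerson-style characterization of truthful mechanisms under linear payoffs:
`(π, p)` is truthful iff `π` is non-decreasing and `p` satisfies the envelope
(payment) formula. -/
theorem stmt_4
    (vl vh : ℝ) (hle : vl ≤ vh) (π p : ℝ → ℝ)
    (hπ_int : IntegrableOn π (Icc vl vh)) :
    (∀ v ∈ Icc vl vh, ∀ v' ∈ Icc vl vh, v * π v' - p v' ≤ v * π v - p v) ↔
      (MonotoneOn π (Icc vl vh) ∧
        ∀ v ∈ Icc vl vh,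
          p v = v * π v - vl * π vl + p vl - ∫ s in vl..v, π s) := by
  have hvl : vl ∈ Icc vl vh := left_mem_Icc.2 hle
  have hint : ∀ x ∈ Icc vl vh, ∀ y ∈ Icc vl vh, IntervalIntegrable π volume x y :=
    fun x hx y hy => (hπ_int.mono_set (uIcc_subset_Icc hx hy)).intervalIntegrable
  have hadd : ∀ x ∈ Icc vl vh, ∀ y ∈ Icc vl vh,
      (∫ s in vl..x, π s) + ∫ s in x..y, π s = ∫ s in vl..y, π s := fun x hx y hy =>
    intervalIntegral.integral_add_adjacent_intervals (hint _ hvl _ hx) (hint _ hx _ hy)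
  have hbound : MonotoneOn π (Icc vl vh) → ∀ x ∈ Icc vl vh, ∀ y ∈ Icc vl vh, x ≤ y →
      ∫ s in x..y, π s ∈ Icc ((y - x) * π x) ((y - x) * π y) := fun hmono x hx y hy hxy =>
    (hmono.mono (Icc_subset_Icc hx.1 hy.2)).intervalIntegral_mem_Icc hxy
  constructor
  · intro h
    have hmono : MonotoneOn π (Icc vl vh) := by
      intro x hx y hy hxy
      rcases hxy.eq_or_lt with rfl | hlt
      · exact le_rfl
      · nlinarith [h x hx y hy, h y hy x hx]
    refine ⟨hmono, fun v hv => ?_⟩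
    have key := eq_of_abs_sub_le_mul_sub (ordConnected_Icc (a := vl) (b := vh))
      (D := fun v => v * π v - p v - ∫ s in vl..v, π s) (g := π)
      (fun x hx y hy hxy => by
        obtain ⟨h1, h2⟩ := hbound hmono x hx y hy hxy
        have h3 := hadd x hx y hy
        have h4 := h x hx y hy
        have h5 := h y hy x hx
        rw [abs_le]
        constructor <;> linarith) hvl hv hv.1
    simp only [intervalIntegral.integral_same] at key
    linarith
  · rintro ⟨hmono, hp⟩ v hv v' hv'
    have h1 := hp v hv
    have h2 := hp v' hv'
    rcases le_total v v' with hvv | hvv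
    · have h3 := (hbound hmono v hv v' hv' hvv).2
      have h4 := hadd v hv v' hv'
      linarith
    · have h3 := (hbound hmono v' hv' v hv hvv).1
      have h4 := hadd v' hv' v hv
      linarith
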